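/- arXiv:1604.01154 — 2 statements merged into one kernel-verified Lean document; each statement's English description precedes it below -/
import Mathlib

section
/- There exists a constant C > 0 such that for every real x ≥ 4 and every prime number p with p² ≤ x, the number of integers k with 1 ≤ k ≤ x that are not divisible by any prime q < p is at most C · x / log p. -/
open scoped ArithmeticFunction.vonMangoldt in
/-- Chebyshev-type bound: for a finite set `R` of positive integers up to `N` that is closed under
taking divisors, `|R| log N` is bounded by a multiple of `N ∑ 1/m`. -/
theorem card_mul_log_le_of_dvd_closed {N : ℕ} {R : Finset ℕ} (hR : R ⊆ Finset.Icc 1 N)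
    (hdvd : ∀ n ∈ R, ∀ m, m ∣ n → m ∈ R) :
    (R.card : ℝ) * Real.log N ≤ (Real.log 4 + 5) * N * ∑ m ∈ R, (m : ℝ)⁻¹ := by
  have hpos : ∀ n ∈ R, 0 < n ∧ n ≤ N := fun n hn => by
    have := Finset.mem_Icc.mp (hR hn)
    omega
  have hlog : ∑ n ∈ R, Real.log n ≤ (Real.log 4 + 4) * N * ∑ m ∈ R, (m : ℝ)⁻¹ := by
    calc ∑ n ∈ R, Real.log n
        = ∑ n ∈ R, ∑ y ∈ n.divisorsAntidiagonal, Λ y.2 := by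
          refine Finset.sum_congr rfl fun n _ => ?_
          rw [Nat.sum_divisorsAntidiagonal' (f := fun _ d => Λ d),
            ArithmeticFunction.vonMangoldt_sum]
      _ = ∑ y ∈ R.biUnion Nat.divisorsAntidiagonal, Λ y.2 := by
          refine (Finset.sum_biUnion fun a _ b _ hab => ?_).symm
          refine Finset.disjoint_left.mpr fun y hya hyb => hab ?_
          rw [← (Nat.mem_divisorsAntidiagonal.mp hya).1, (Nat.mem_divisorsAntidiagonal.mp hyb).1]
      _ ≤ ∑ y ∈ R.sigma fun m => Finset.Ioc 0 ⌊(N : ℝ) / m⌋₊, Λ y.2 := by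
          rw [← Finset.sum_image (s := R.biUnion Nat.divisorsAntidiagonal)
            (g := fun y : ℕ × ℕ => (⟨y.1, y.2⟩ : Σ _ : ℕ, ℕ)) (f := fun y => Λ y.2)]
          · refine Finset.sum_le_sum_of_subset_of_nonneg ?_
              fun _ _ _ => ArithmeticFunction.vonMangoldt_nonneg
            intro z hz
            simp only [Finset.mem_image, Finset.mem_biUnion, Nat.mem_divisorsAntidiagonal] at hz
            obtain ⟨⟨m, d⟩, ⟨n, hn, hmd, hn0⟩, rfl⟩ := hz
            dsimp only at hmd
            have hm : 0 < m := Nat.pos_of_ne_zero fun h => hn0 (by rw [← hmd, h, zero_mul])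
            have hd : 0 < d := Nat.pos_of_ne_zero fun h => hn0 (by rw [← hmd, h, mul_zero])
            rw [Finset.mem_sigma, Finset.mem_Ioc]
            refine ⟨hdvd n hn m ⟨d, hmd.symm⟩, hd, ?_⟩
            rw [Nat.floor_div_natCast, Nat.floor_natCast, Nat.le_div_iff_mul_le hm, mul_comm, hmd]
            exact (hpos n hn).2
          · rintro ⟨a, b⟩ _ ⟨c, d⟩ _ h
            simpa using h
      _ = ∑ m ∈ R, Chebyshev.psi ((N : ℝ) / m) := by
          rw [Finset.sum_sigma]
          rfl
      _ ≤ ∑ m ∈ R, (Real.log 4 + 4) * ((N : ℝ) / m) :=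
          Finset.sum_le_sum fun m _ => Chebyshev.psi_le_const_mul_self (by positivity)
      _ = (Real.log 4 + 4) * N * ∑ m ∈ R, (m : ℝ)⁻¹ := by
          rw [Finset.mul_sum]
          exact Finset.sum_congr rfl fun m _ => by ring
  have hquot : ∑ n ∈ R, (Real.log N - Real.log n) ≤ N * ∑ m ∈ R, (m : ℝ)⁻¹ := by
    rw [Finset.mul_sum]
    refine Finset.sum_le_sum fun n hn => ?_
    have h := hpos n hn
    have hn0 : (n : ℝ) ≠ 0 := by exact_mod_cast h.1.ne'
    have hN0 : (N : ℝ) ≠ 0 := by exact_mod_cast (h.1.trans_le h.2).ne'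
    rw [← Real.log_div hN0 hn0, ← div_eq_mul_inv]
    exact Real.log_le_self (by positivity)
  rw [Finset.sum_sub_distrib, Finset.sum_const, nsmul_eq_mul] at hquot
  linarith

/-- If no element of `R` has a prime factor below `p`, then multiplying by the integers below `p`
gives distinct products, which bounds `∑ 1/m` over `R`. -/
theorem sum_inv_mul_log_le_of_rough {N p : ℕ} (hp : 0 < p) {R : Finset ℕ}
    (hR : R ⊆ Finset.Icc 1 N) (hrough : ∀ m ∈ R, ∀ q : ℕ, q.Prime → q < p → ¬ q ∣ m) :
    (∑ m ∈ R, (m : ℝ)⁻¹) * Real.log p ≤ 1 + Real.log (N * p) := by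
  have hcop : ∀ m ∈ R, ∀ a ∈ Finset.Icc 1 (p - 1), m.Coprime a := fun m hm a ha => by
    rw [Finset.mem_Icc] at ha
    refine Nat.Coprime.symm (Nat.coprime_of_dvd fun q hq hqa hqm => ?_)
    have := Nat.le_of_dvd (by omega) hqa
    exact hrough m hm q hq (by omega) hqm
  have hinj : Set.InjOn (fun y : ℕ × ℕ => y.1 * y.2) (R ×ˢ Finset.Icc 1 (p - 1) : Finset _) := by
    rintro ⟨m, a⟩ h₁ ⟨n, b⟩ h₂ h
    simp only [Finset.coe_product, Set.mem_prod, Finset.mem_coe] at h₁ h₂ h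
    have hmn : m = n := Nat.dvd_antisymm
      ((hcop m h₁.1 b h₂.2).dvd_of_dvd_mul_right ⟨a, h.symm⟩)
      ((hcop n h₂.1 a h₁.2).dvd_of_dvd_mul_right ⟨b, h⟩)
    subst hmn
    have := Finset.mem_Icc.mp (hR h₁.1)
    rw [Nat.eq_of_mul_eq_mul_left (by omega) h]
  have hharm : Real.log p ≤ ∑ a ∈ Finset.Icc 1 (p - 1), (a : ℝ)⁻¹ := by
    have h := log_add_one_le_harmonic (p - 1)
    rw [harmonic_eq_sum_Icc] at h
    push_cast [Nat.sub_add_cancel hp] at h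
    exact h
  calc (∑ m ∈ R, (m : ℝ)⁻¹) * Real.log p
      ≤ (∑ m ∈ R, (m : ℝ)⁻¹) * ∑ a ∈ Finset.Icc 1 (p - 1), (a : ℝ)⁻¹ :=
        mul_le_mul_of_nonneg_left hharm (Finset.sum_nonneg fun _ _ => by positivity)
    _ = ∑ y ∈ R ×ˢ Finset.Icc 1 (p - 1), ((y.1 * y.2 : ℕ) : ℝ)⁻¹ := by
        rw [Finset.sum_mul_sum, ← Finset.sum_product']
        exact Finset.sum_congr rfl fun y _ => by rw [Nat.cast_mul, mul_inv]
    _ = ∑ n ∈ (R ×ˢ Finset.Icc 1 (p - 1)).image (fun y => y.1 * y.2 : ℕ × ℕ → ℕ), (n : ℝ)⁻¹ :=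
        (Finset.sum_image (f := fun n : ℕ => (n : ℝ)⁻¹) hinj).symm
    _ ≤ ∑ n ∈ Finset.Icc 1 (N * p), (n : ℝ)⁻¹ := by
        refine Finset.sum_le_sum_of_subset_of_nonneg ?_ fun _ _ _ => by positivity
        refine Finset.image_subset_iff.mpr fun y hy => ?_
        rw [Finset.mem_product] at hy
        have h₁ := Finset.mem_Icc.mp (hR hy.1)
        have h₂ := Finset.mem_Icc.mp hy.2
        exact Finset.mem_Icc.mpr ⟨Nat.mul_pos h₁.1 h₂.1, Nat.mul_le_mul h₁.2 (by omega)⟩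
    _ ≤ 1 + Real.log (N * p) := by
        have h := harmonic_le_one_add_log (N * p)
        rw [harmonic_eq_sum_Icc] at h
        push_cast at h
        exact h

open scoped Classical in
/-- Sieve bound: there is a constant `C > 0` such that for every real `x ≥ 4` and
every prime `p` with `p² ≤ x`, the number of integers `k` with `1 ≤ k ≤ x` having
no prime factor smaller than `p` is at most `C · x / log p`. -/
theorem sieve_count_bound :
    ∃ C : ℝ, 0 < C ∧ ∀ x : ℝ, 4 ≤ x → ∀ p : ℕ, p.Prime → (p : ℝ) ^ 2 ≤ x →
      (((Finset.Icc 1 ⌊x⌋₊).filter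
          (fun k => ∀ q : ℕ, q.Prime → q < p → ¬ q ∣ k)).card : ℝ) ≤
        C * x / Real.log p := by
  have hlog4 : 0 < Real.log 4 := Real.log_pos (by norm_num)
  refine ⟨3 * (Real.log 4 + 5), by positivity, fun x hx p hp hpx => ?_⟩
  set N := ⌊x⌋₊
  set R := (Finset.Icc 1 N).filter (fun k => ∀ q : ℕ, q.Prime → q < p → ¬ q ∣ k) with hRdef
  have hp1 : (1 : ℝ) < p := by exact_mod_cast hp.one_lt
  have hlogp : 0 < Real.log p := Real.log_pos hp1
  have hN : 4 ≤ N := Nat.le_floor (by exact_mod_cast hx)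
  have hNx : (N : ℝ) ≤ x := Nat.floor_le (by linarith)
  have hpN : (p : ℝ) ≤ N := by
    exact_mod_cast Nat.le_floor (show (p : ℝ) ≤ x by nlinarith)
  have hN4 : (4 : ℝ) ≤ N := by exact_mod_cast hN
  have hlogN : 1 ≤ Real.log N := by
    rw [Real.le_log_iff_exp_le (by linarith)]
    linarith [Real.exp_one_lt_d9]
  have hR : R ⊆ Finset.Icc 1 N := Finset.filter_subset _ _
  have hcard := card_mul_log_le_of_dvd_closed hR fun n hn m hmn => by
    rw [hRdef, Finset.mem_filter, Finset.mem_Icc] at hn ⊢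
    have hn0 : 0 < n := hn.1.1
    exact ⟨⟨Nat.pos_of_dvd_of_pos hmn hn0, (Nat.le_of_dvd hn0 hmn).trans hn.1.2⟩,
      fun q hq hqp hqm => hn.2 q hq hqp (hqm.trans hmn)⟩
  have hsum : (∑ m ∈ R, (m : ℝ)⁻¹) * Real.log p ≤ 3 * Real.log N := by
    have h := sum_inv_mul_log_le_of_rough hp.pos hR
      fun m hm => (Finset.mem_filter.mp hm).2
    rw [Real.log_mul (by linarith) (by linarith)] at h
    linarith [Real.log_le_log (by linarith) hpN]
  rw [le_div_iff₀ hlogp]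
  refine le_of_mul_le_mul_right ?_ (by linarith : 0 < Real.log N)
  calc (R.card : ℝ) * Real.log p * Real.log N
      = R.card * Real.log N * Real.log p := by ring
    _ ≤ (Real.log 4 + 5) * N * (∑ m ∈ R, (m : ℝ)⁻¹) * Real.log p := by gcongr
    _ = (Real.log 4 + 5) * N * ((∑ m ∈ R, (m : ℝ)⁻¹) * Real.log p) := by ring
    _ ≤ (Real.log 4 + 5) * x * (3 * Real.log N) := by gcongr
    _ = 3 * (Real.log 4 + 5) * x * Real.log N := by ring
end

section
/- There exist constants c₁, c₂ > 0 such that for all sufficiently large natural numbers n, c₁ · n / log log n ≤ #{m ∈ ℕ : 2 ≤ m ≤ n, log n < minFac(m) and (minFac(m))² ≤ n} ≤ c₂ · n / log log n. -/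
theorem Nat.Prime.pow_div_dvd_factorial {p : ℕ} (hp : p.Prime) (n : ℕ) :
    p ^ (n / p) ∣ n.factorial := by
  rw [hp.pow_dvd_factorial_iff (b := Nat.log p n + 2) (by omega)]
  have h := Finset.single_le_sum (f := fun i ↦ n / p ^ i) (s := Finset.Ico 1 (Nat.log p n + 2))
    (fun _ _ ↦ Nat.zero_le _) (show 1 ∈ Finset.Ico 1 (Nat.log p n + 2) by simp)
  simpa using h

theorem prod_primesLE_pow_div_dvd_factorial (n : ℕ) :
    ∏ p ∈ n.primesLE, p ^ (n / p) ∣ n.factorial := by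
  refine Finset.prod_dvd_of_isRelPrime ?_ fun p hp ↦
    (Nat.prime_of_mem_primesLE hp).pow_div_dvd_factorial n
  intro p hp q hq hpq
  exact Nat.coprime_iff_isRelPrime.mp <| Nat.Coprime.pow _ _ <|
    (Nat.coprime_primes (Nat.prime_of_mem_primesLE hp) (Nat.prime_of_mem_primesLE hq)).mpr hpq

/-- The upper bound in Mertens' first theorem. -/
theorem sum_primesLE_log_div_le {n : ℕ} (hn : n ≠ 0) :
    ∑ p ∈ n.primesLE, Real.log p / p ≤ Real.log n + Real.log 4 := by
  have hn' : (0 : ℝ) < n := by positivity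
  have hfac : ∑ p ∈ n.primesLE, ((n / p : ℕ) : ℝ) * Real.log p ≤ n * Real.log n := by
    have h : ∏ p ∈ n.primesLE, p ^ (n / p) ≤ n ^ n :=
      (Nat.le_of_dvd n.factorial_pos (prod_primesLE_pow_div_dvd_factorial n)).trans
        n.factorial_le_pow
    have hpos : (0 : ℝ) < ∏ p ∈ n.primesLE, (p : ℝ) ^ (n / p) :=
      Finset.prod_pos fun p hp ↦ pow_pos (by exact_mod_cast (Nat.prime_of_mem_primesLE hp).pos) _
    have h' : ∏ p ∈ n.primesLE, (p : ℝ) ^ (n / p) ≤ (n : ℝ) ^ n := by exact_mod_cast h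
    have := Real.log_le_log hpos h'
    rw [Real.log_prod fun p hp ↦ pow_ne_zero _ <| by
      exact_mod_cast (Nat.prime_of_mem_primesLE hp).ne_zero] at this
    simpa [Real.log_pow] using this
  have htheta := Chebyshev.theta_le_log4_mul_x hn'.le
  rw [Chebyshev.theta_eq_sum_primesLE_log] at htheta
  have key : n * ∑ p ∈ n.primesLE, Real.log p / p ≤
      ∑ p ∈ n.primesLE, (((n / p : ℕ) : ℝ) * Real.log p + Real.log p) := by
    rw [Finset.mul_sum]
    refine Finset.sum_le_sum fun p _ ↦ ?_
    have h1 : (n : ℝ) / p ≤ (n / p : ℕ) + 1 := by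
      rw [← Nat.floor_div_eq_div (K := ℝ)]
      exact (Nat.lt_floor_add_one _).le
    calc n * (Real.log p / p) = n / p * Real.log p := by ring
      _ ≤ ((n / p : ℕ) + 1) * Real.log p := by
        gcongr
      _ = _ := by ring
  rw [Finset.sum_add_distrib] at key
  refine le_of_mul_le_mul_left ?_ hn'
  linarith

/-- The upper bound in Mertens' second theorem. -/
theorem exists_sum_primesLE_inv_le :
    ∃ C : ℝ, ∀ n : ℕ, 2 ≤ n →
      ∑ p ∈ n.primesLE, (p : ℝ)⁻¹ ≤ Real.log (Real.log n) + C := by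
  obtain ⟨D, hD⟩ : ∃ D : ℝ, ∀ n : ℕ, 2 ≤ n → ∑ p ∈ n.primesLE, (p : ℝ)⁻¹
      - (∑ p ∈ n.primesLE, Real.log p / p) / Real.log n
      ≤ Real.log (Real.log n) + D - Real.log 4 / Real.log n := by
    refine ⟨Real.log 4 / Real.log 2 - Real.log (Real.log 2), fun n hn ↦ ?_⟩
    induction n, hn using Nat.le_induction with
    | base =>
      have h2 : Nat.primesLE 2 = {2} := by decide
      have : Real.log 2 ≠ 0 := (Real.log_pos one_lt_two).ne'
      rw [h2]
      simp
      field_simp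
      linarith
    | succ n hn ih =>
      set A := ∑ p ∈ n.primesLE, Real.log p / p with hA
      have hAle := sum_primesLE_log_div_le (n := n) (by omega)
      have hL : 0 < Real.log n := Real.log_pos (by exact_mod_cast hn)
      have hLM : Real.log n ≤ Real.log (n + 1 : ℕ) :=
        Real.log_le_log (by positivity) (by push_cast; linarith)
      have hstep : ∑ p ∈ (n + 1).primesLE, (p : ℝ)⁻¹
          - (∑ p ∈ (n + 1).primesLE, Real.log p / p) / Real.log (n + 1 : ℕ)
          = ∑ p ∈ n.primesLE, (p : ℝ)⁻¹ - A / Real.log (n + 1 : ℕ) := by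
        rw [Nat.primesLE_succ]
        split_ifs with hp
        · rw [Finset.sum_insert (Nat.notMem_primesLE n), Finset.sum_insert (Nat.notMem_primesLE n),
            ← hA]
          have : Real.log (n + 1 : ℕ) ≠ 0 := (hL.trans_le hLM).ne'
          field_simp
          ring
        · rfl
      rw [hstep]
      generalize Real.log (n + 1 : ℕ) = M at *
      generalize Real.log n = L at *
      have hM : 0 < M := hL.trans_le hLM
      have hdiff : 0 ≤ 1 / L - 1 / M := sub_nonneg.mpr (one_div_le_one_div_of_le hL hLM)
      have h1 : A * (1 / L - 1 / M) ≤ (L + Real.log 4) * (1 / L - 1 / M) := by gcongr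
      have h2 : 1 - L / M ≤ Real.log M - Real.log L := by
        have := Real.log_le_sub_one_of_pos (div_pos hL hM)
        rw [Real.log_div hL.ne' hM.ne'] at this
        linarith
      have h3 : L * (1 / L - 1 / M) = 1 - L / M := by field_simp
      have h4 : A / L - A / M = A * (1 / L - 1 / M) := by ring
      have h5 : Real.log 4 / L - Real.log 4 / M = Real.log 4 * (1 / L - 1 / M) := by ring
      linarith
  refine ⟨D + 1, fun n hn ↦ ?_⟩
  have hL : 0 < Real.log n := Real.log_pos (by exact_mod_cast hn)
  have h1 := hD n hn
  have h2 := div_le_div_of_nonneg_right (sum_primesLE_log_div_le (n := n) (by omega)) hL.le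
  rw [add_div, div_self hL.ne'] at h2
  linarith

theorem sum_primesLE_inv_mul_sub_one_le (n : ℕ) :
    ∑ p ∈ n.primesLE, ((p : ℝ) * (p - 1))⁻¹ ≤ 1 := by
  have h : ∀ m : ℕ, ∑ k ∈ Finset.Icc 2 (m + 1), ((k : ℝ) * (k - 1))⁻¹ = 1 - 1 / (m + 1) := by
    intro m
    induction m with
    | zero => simp
    | succ m ih =>
      rw [Finset.sum_Icc_succ_top (by omega), ih]
      push_cast
      have : (m : ℝ) + 1 + 1 - 1 ≠ 0 := by ring_nf; positivity
      field_simp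
      ring
  calc ∑ p ∈ n.primesLE, ((p : ℝ) * (p - 1))⁻¹
      ≤ ∑ k ∈ Finset.Icc 2 (n + 1), ((k : ℝ) * (k - 1))⁻¹ := by
        refine Finset.sum_le_sum_of_subset_of_nonneg (fun p hp ↦ ?_) fun k hk _ ↦ ?_
        · rw [Nat.mem_primesLE] at hp
          exact Finset.mem_Icc.mpr ⟨hp.2.two_le, by omega⟩
        · have : (2 : ℝ) ≤ k := by exact_mod_cast (Finset.mem_Icc.mp hk).1
          have : (0 : ℝ) ≤ k - 1 := by linarith
          positivity
    _ ≤ 1 := by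
      rw [h]
      have : (0 : ℝ) ≤ 1 / (n + 1) := by positivity
      linarith

/-- The lower bound in Mertens' third theorem. -/
theorem exists_div_log_le_prod_primesLE :
    ∃ c : ℝ, 0 < c ∧ ∀ n : ℕ, 2 ≤ n →
      c / Real.log n ≤ ∏ p ∈ n.primesLE, (1 - (p : ℝ)⁻¹) := by
  obtain ⟨C, hC⟩ := exists_sum_primesLE_inv_le
  refine ⟨Real.exp (-(C + 1)), Real.exp_pos _, fun n hn ↦ ?_⟩
  have hL : 0 < Real.log n := Real.log_pos (by exact_mod_cast hn)
  calc Real.exp (-(C + 1)) / Real.log n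
      = Real.exp (-(Real.log (Real.log n) + C + 1)) := by
        rw [show -(Real.log (Real.log n) + C + 1) = -(C + 1) - Real.log (Real.log n) by ring,
          Real.exp_sub, Real.exp_log hL]
    _ ≤ Real.exp (∑ p ∈ n.primesLE, -((p : ℝ)⁻¹ + ((p : ℝ) * (p - 1))⁻¹)) := by
        rw [Finset.sum_neg_distrib, Finset.sum_add_distrib]
        refine Real.exp_le_exp.mpr ?_
        linarith [hC n hn, sum_primesLE_inv_mul_sub_one_le n]
    _ = ∏ p ∈ n.primesLE, Real.exp (-((p : ℝ)⁻¹ + ((p : ℝ) * (p - 1))⁻¹)) := Real.exp_sum _ _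
    _ ≤ _ := by
        refine Finset.prod_le_prod (fun _ _ ↦ (Real.exp_pos _).le) fun p hp ↦ ?_
        have hp2 : (2 : ℝ) ≤ p := by exact_mod_cast Nat.two_le_of_mem_primesLE hp
        have hp1 : (0 : ℝ) < p - 1 := by linarith
        rw [Real.exp_neg]
        refine inv_le_of_inv_le₀ (by rw [sub_pos]; exact inv_lt_one_of_one_lt₀ (by linarith)) ?_
        have := Real.add_one_le_exp ((p : ℝ)⁻¹ + ((p : ℝ) * (p - 1))⁻¹)
        refine le_trans (le_of_eq ?_) this
        have h0 : (p : ℝ) ≠ 0 := by positivity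
        field_simp
        ring

/-- The upper bound in Mertens' third theorem. -/
theorem prod_primesLE_one_sub_inv_le {n : ℕ} (hn : n ≠ 0) :
    ∏ p ∈ n.primesLE, (1 - (p : ℝ)⁻¹) ≤ 1 / Real.log (n + 1) := by
  let f : ℕ →* ℝ :=
    { toFun := fun m ↦ (m : ℝ)⁻¹
      map_one' := by simp
      map_mul' := fun a b ↦ by push_cast; exact mul_inv _ _ }
  have hL : 0 < Real.log (n + 1) := Real.log_pos (by
    have : (0 : ℝ) < n := by positivity
    linarith)
  obtain ⟨hs, hprod⟩ :=
    EulerProduct.summable_and_hasSum_smoothNumbers_prod_primesBelow_geometric (f := f)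
      (fun {p} hp ↦ by
        simpa [f] using inv_lt_one_of_one_lt₀ (by exact_mod_cast hp.one_lt : (1 : ℝ) < p)) (n + 1)
  have hle : Real.log (n + 1) ≤ ∏ p ∈ n.primesLE, (1 - (p : ℝ)⁻¹)⁻¹ := by
    have hmem : ∀ m ∈ Finset.Icc 1 n, m ∈ (n + 1).smoothNumbers := fun m hm ↦ by
      rw [Finset.mem_Icc] at hm
      exact Nat.mem_smoothNumbers_of_lt hm.1 (by omega)
    calc Real.log (n + 1) ≤ ∑ m ∈ Finset.Icc 1 n, (m : ℝ)⁻¹ := by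
          have := log_add_one_le_harmonic n
          rw [harmonic_eq_sum_Icc] at this
          simpa using this
      _ = ∑ m ∈ (Finset.Icc 1 n).subtype (· ∈ (n + 1).smoothNumbers), f m :=
          (Finset.sum_subtype_of_mem (fun m : ℕ ↦ (m : ℝ)⁻¹) hmem).symm
      _ ≤ ∏ p ∈ (n + 1).primesBelow, (1 - f p)⁻¹ :=
          sum_le_hasSum _ (fun m _ ↦ inv_nonneg.mpr (Nat.cast_nonneg _)) hprod
      _ = _ := rfl
  rw [Finset.prod_inv_distrib] at hle
  rw [one_div]
  exact le_inv_of_le_inv₀ hL hle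

theorem totient_primorial (n : ℕ) :
    ((primorial n).totient : ℝ) = primorial n * ∏ p ∈ n.primesLE, (1 - (p : ℝ)⁻¹) := by
  have := Nat.totient_eq_mul_prod_factors (primorial n)
  rw [primeFactors_primorial] at this
  have h := congrArg (Rat.cast (K := ℝ)) this
  push_cast at h
  exact h

theorem totient_mul_div_le_card_Ico_filter_coprime (a k n : ℕ) :
    a.totient * (n / a) ≤ ((Finset.Ico k (k + n)).filter a.Coprime).card := by
  have h : ∀ q : ℕ, ((Finset.Ico k (k + a * q)).filter a.Coprime).card = a.totient * q := by
    intro q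
    induction q with
    | zero => simp
    | succ q ih =>
      rw [← Finset.Ico_union_Ico_eq_Ico (b := k + a * q) (by omega) (by rw [mul_add]; omega),
        Finset.filter_union, Finset.card_union_of_disjoint
          (Finset.disjoint_filter_filter (Finset.Ico_disjoint_Ico_consecutive _ _ _)), ih,
        show k + a * (q + 1) = k + a * q + a by ring, Nat.filter_coprime_Ico_eq_totient]
      ring
  rw [← h]
  refine Finset.card_le_card (Finset.filter_subset_filter _ (Finset.Ico_subset_Ico_right ?_))
  have := Nat.mul_div_le n a
  omega

theorem card_Ico_filter_coprime_le {a x : ℕ} (ha : a ≠ 0) (hax : a ≤ x) (k : ℕ) :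
    (((Finset.Ico k (k + x)).filter a.Coprime).card : ℝ) ≤ 2 * (a.totient / a * x) := by
  have ha' : (0 : ℝ) < a := by positivity
  have h1 : (1 : ℝ) ≤ x / a := (one_le_div ha').mpr (by exact_mod_cast hax)
  calc (((Finset.Ico k (k + x)).filter a.Coprime).card : ℝ)
      ≤ a.totient * ((x / a : ℕ) + 1) := by exact_mod_cast Nat.Ico_filter_coprime_le k x ha
    _ ≤ a.totient * (x / a + x / a) := by
        gcongr
        exact Nat.cast_div_le
    _ = _ := by ring

theorem le_card_Ico_filter_coprime {a x : ℕ} (ha : a ≠ 0) (hax : 2 * a ≤ x) (k : ℕ) :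
    a.totient / a * x / 2 ≤ (((Finset.Ico k (k + x)).filter a.Coprime).card : ℝ) := by
  have ha' : (0 : ℝ) < a := by positivity
  have h1 : (2 : ℝ) ≤ x / a := (le_div_iff₀ ha').mpr (by exact_mod_cast hax)
  have h2 : (x : ℝ) / a ≤ (x / a : ℕ) + 1 := by
    rw [← Nat.floor_div_eq_div (K := ℝ)]
    exact (Nat.lt_floor_add_one _).le
  calc a.totient / a * x / 2 = a.totient * ((x / a : ℝ) / 2) := by ring
    _ ≤ a.totient * (x / a : ℕ) := by
        gcongr
        linarith
    _ ≤ _ := by exact_mod_cast totient_mul_div_le_card_Ico_filter_coprime a k x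

theorem coprime_primorial_of_lt_minFac {w m : ℕ} (h : w < m.minFac) : (primorial w).Coprime m := by
  refine Nat.coprime_of_dvd fun q hq hqw hqm ↦ ?_
  exact (((hq.dvd_primorial_iff).mp hqw).trans_lt h).not_ge (Nat.minFac_le_of_dvd hq.two_le hqm)

theorem lt_minFac_of_coprime_primorial {w m : ℕ} (hm : m ≠ 1) (h : (primorial w).Coprime m) :
    w < m.minFac := by
  by_contra! hle
  have hq := Nat.minFac_prime hm
  exact Nat.not_coprime_of_dvd_of_dvd hq.one_lt (hq.dvd_primorial_iff.mpr hle) m.minFac_dvd h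

/-- An integer in `[1, n]` free of prime factors `≤ w` is `1`, a prime, has a prime factor in
`(w, K]`, or has least prime factor in `(K, √n]`. -/
theorem card_coprime_primorial_le {n w K : ℕ} {T : Finset ℕ}
    (hT : ∀ m ∈ Finset.Icc 2 n, K < m.minFac → m.minFac ^ 2 ≤ n → m ∈ T) :
    ((Finset.Ico 1 (1 + n)).filter (primorial w).Coprime).card ≤
      T.card + 1 + n.primeCounting + ∑ p ∈ K.primesLE.filter (w < ·),
        ((Finset.Ico 1 (1 + n / p)).filter (primorial w).Coprime).card := by
  have hsub : (Finset.Ico 1 (1 + n)).filter (primorial w).Coprime ⊆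
      T ∪ {1} ∪ n.primesLE ∪ (K.primesLE.filter (w < ·)).biUnion fun p ↦
        ((Finset.Ico 1 (1 + n / p)).filter (primorial w).Coprime).image (p * ·) := by
    intro m hm
    obtain ⟨hm, hcop⟩ := Finset.mem_filter.mp hm
    rw [Finset.mem_Ico] at hm
    simp only [Finset.mem_union, Finset.mem_singleton, Finset.mem_biUnion, Finset.mem_filter,
      Finset.mem_image, Finset.mem_Ico, Nat.mem_primesLE]
    by_cases h1 : m = 1
    · tauto
    have hq := Nat.minFac_prime h1
    have hwq := lt_minFac_of_coprime_primorial h1 hcop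
    obtain hqK | hKq := le_or_gt m.minFac K
    · refine Or.inr ⟨m.minFac, ⟨⟨hqK, hq⟩, hwq⟩, m / m.minFac, ⟨⟨?_, ?_⟩, ?_⟩,
        Nat.mul_div_cancel' m.minFac_dvd⟩
      · exact Nat.div_pos (Nat.minFac_le (by omega)) hq.pos
      · have : m / m.minFac ≤ n / m.minFac := Nat.div_le_div_right (by omega)
        omega
      · exact hcop.coprime_dvd_right (Nat.div_dvd_of_dvd m.minFac_dvd)
    · by_cases hp : m.Prime
      · exact Or.inl (Or.inr ⟨by omega, hp⟩)
      · refine Or.inl (Or.inl (Or.inl (hT m (Finset.mem_Icc.mpr (by omega)) hKq ?_)))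
        have := Nat.minFac_sq_le_self (by omega) hp
        omega
  refine (Finset.card_le_card hsub).trans ?_
  refine (Finset.card_union_le _ _).trans (add_le_add ?_ ?_)
  · refine (Finset.card_union_le _ _).trans (add_le_add ?_ ?_)
    · exact (Finset.card_union_le _ _).trans (by simp)
    · rw [Nat.primesLE_card_eq_primeCounting]
  · exact Finset.card_biUnion_le.trans (Finset.sum_le_sum fun p _ ↦ Finset.card_image_le)

theorem primorial_floor_div_four_le {x : ℝ} (hx : 0 ≤ x) :
    (primorial ⌊x / 4⌋₊ : ℝ) ≤ Real.exp (x / 2) := by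
  have h4 : Real.log 4 ≤ 2 := by
    rw [show (4 : ℝ) = 2 ^ 2 by norm_num, Real.log_pow]
    have := Real.log_two_lt_d9
    norm_num
    linarith
  calc (primorial ⌊x / 4⌋₊ : ℝ) ≤ (4 : ℝ) ^ ⌊x / 4⌋₊ := by
        exact_mod_cast primorial_le_four_pow _
    _ = Real.exp (⌊x / 4⌋₊ * Real.log 4) := by
        rw [Real.exp_nat_mul, Real.exp_log (by norm_num)]
    _ ≤ Real.exp (x / 4 * 2) := by
        gcongr
        exact Nat.floor_le (by positivity)
    _ = _ := by ring_nf

theorem two_mul_le_exp_half {x : ℝ} (hx : 16 ≤ x) : 2 * x ≤ Real.exp (x / 2) := by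
  have := Real.quadratic_le_exp_of_nonneg (x := x / 2) (by linarith)
  nlinarith

theorem totient_primorial_div (n : ℕ) :
    ((primorial n).totient / primorial n : ℝ) = ∏ p ∈ n.primesLE, (1 - (p : ℝ)⁻¹) := by
  rw [totient_primorial, mul_div_cancel_left₀]
  exact_mod_cast primorial_ne_zero n

theorem totient_primorial_floor_div_le {x : ℝ} (hx : 16 ≤ x) :
    ((primorial ⌊x / 4⌋₊).totient / primorial ⌊x / 4⌋₊ : ℝ) ≤ 2 / Real.log x := by
  have hw : ⌊x / 4⌋₊ ≠ 0 := (Nat.floor_pos.mpr (by linarith)).ne'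
  have hlog : Real.log x / 2 ≤ Real.log (⌊x / 4⌋₊ + 1) := by
    rw [← Real.log_sqrt (by linarith)]
    refine Real.log_le_log (by positivity) (le_trans ?_ (Nat.lt_floor_add_one _).le)
    rw [Real.sqrt_le_iff]
    constructor <;> nlinarith
  have hpos : 0 < Real.log x := Real.log_pos (by linarith)
  rw [totient_primorial_div]
  calc _ ≤ 1 / Real.log (⌊x / 4⌋₊ + 1) := prod_primesLE_one_sub_inv_le hw
    _ ≤ 1 / (Real.log x / 2) := by gcongr
    _ = _ := by field_simp

/-- There are `O(n / log log n)` integers up to `n` without prime factors `≤ log n`. -/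
theorem card_le_of_log_lt_minFac {n : ℕ} {T : Finset ℕ} (hn : 16 ≤ Real.log n)
    (hT : ∀ m ∈ T, m ∈ Finset.Icc 2 n ∧ Real.log n < m.minFac) :
    (T.card : ℝ) ≤ 4 * n / Real.log (Real.log n) := by
  have hn0 : (0 : ℝ) < n := by
    rcases n.eq_zero_or_pos with rfl | h
    · norm_num at hn
    · exact_mod_cast h
  have hP : primorial ⌊Real.log n / 4⌋₊ ≤ n := by
    have : Real.exp (Real.log n / 2) ≤ Real.exp (Real.log n) :=
      Real.exp_le_exp.mpr (by linarith)
    rw [Real.exp_log hn0] at this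
    exact_mod_cast (primorial_floor_div_four_le (by linarith)).trans this
  calc (T.card : ℝ)
      ≤ ((Finset.Ico 1 (1 + n)).filter (primorial ⌊Real.log n / 4⌋₊).Coprime).card := by
        refine Nat.cast_le.mpr (Finset.card_le_card fun m hm ↦ ?_)
        obtain ⟨hm, hlt⟩ := hT m hm
        rw [Finset.mem_Icc] at hm
        refine Finset.mem_filter.mpr ⟨Finset.mem_Ico.mpr (by omega),
          coprime_primorial_of_lt_minFac ?_⟩
        refine (Nat.floor_lt (by linarith)).mpr ?_
        linarith
    _ ≤ 2 * (_ * n) := card_Ico_filter_coprime_le (primorial_ne_zero _) hP 1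
    _ ≤ 2 * (2 / Real.log (Real.log n) * n) := by
        have := totient_primorial_floor_div_le hn
        gcongr 2 * (?_ * _)
    _ = _ := by ring

theorem sum_primes_card_coprime_primorial_le {n : ℕ} (hn : 16 ≤ Real.log n)
    (hlog : 64 ≤ Real.log (Real.log n))
    (hpi : (⌊Real.log n⌋₊.primeCounting : ℝ) ≤ 2 * Real.log n / Real.log (Real.log n)) :
    ∑ p ∈ ⌊Real.log n⌋₊.primesLE.filter (⌊Real.log n / 4⌋₊ < ·),
        (((Finset.Ico 1 (1 + n / p)).filter (primorial ⌊Real.log n / 4⌋₊).Coprime).card : ℝ) ≤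
      (primorial ⌊Real.log n / 4⌋₊).totient / primorial ⌊Real.log n / 4⌋₊ * n / 4 := by
  have hn0 : (0 : ℝ) < n := by
    rcases n.eq_zero_or_pos with rfl | h
    · norm_num at hn
    · exact_mod_cast h
  have hexp : Real.exp (Real.log n / 2) * Real.exp (Real.log n / 2) = n := by
    rw [← Real.exp_add, add_halves, Real.exp_log hn0]
  set l := Real.log n with hl
  set P := primorial ⌊l / 4⌋₊ with hP
  have hPle : (P : ℝ) ≤ Real.exp (l / 2) := primorial_floor_div_four_le (by linarith)
  have hle : 2 * l ≤ Real.exp (l / 2) := two_mul_le_exp_half hn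
  set ρ : ℝ := P.totient / P with hρ
  have hρ0 : 0 ≤ ρ := by positivity
  have hterm : ∀ p ∈ ⌊l⌋₊.primesLE.filter (⌊l / 4⌋₊ < ·),
      (((Finset.Ico 1 (1 + n / p)).filter P.Coprime).card : ℝ) ≤ 8 * (ρ * n) / l := by
    intro p hp
    obtain ⟨hp, hwp⟩ := Finset.mem_filter.mp hp
    rw [Nat.mem_primesLE, Nat.le_floor_iff (by linarith)] at hp
    have hlp : l / 4 < p := (Nat.floor_lt (by linarith)).mp hwp
    have hPp : P ≤ n / p := by
      rw [Nat.le_div_iff_mul_le hp.2.pos]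
      have : (P : ℝ) * p ≤ n := by
        rw [← hexp]
        gcongr
        linarith
      exact_mod_cast this
    calc _ ≤ 2 * (ρ * (n / p : ℕ)) := card_Ico_filter_coprime_le (primorial_ne_zero _) hPp 1
      _ ≤ 2 * (ρ * (n / (l / 4))) := by
        gcongr
        exact Nat.cast_div_le.trans (by gcongr)
      _ = _ := by field_simp; ring
  calc _ ≤ ((⌊l⌋₊.primesLE.filter (⌊l / 4⌋₊ < ·)).card : ℝ) * (8 * (ρ * n) / l) := by
        rw [← nsmul_eq_mul]
        exact Finset.sum_le_card_nsmul _ _ _ hterm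
    _ ≤ (2 * l / Real.log l) * (8 * (ρ * n) / l) := by
        gcongr
        refine le_trans ?_ hpi
        rw [← Nat.primesLE_card_eq_primeCounting]
        exact_mod_cast Finset.card_filter_le _ _
    _ = 16 * (ρ * n) / Real.log l := by field_simp; ring
    _ ≤ 16 * (ρ * n) / 64 := by gcongr
    _ = _ := by ring

theorem le_card_of_log_lt_minFac {n : ℕ} {T : Finset ℕ} {c : ℝ} (hc : 0 < c)
    (hprod : ∀ w : ℕ, 2 ≤ w → c / Real.log w ≤ ∏ p ∈ w.primesLE, (1 - (p : ℝ)⁻¹))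
    (hn : 16 ≤ Real.log n) (hlog : 64 ≤ Real.log (Real.log n))
    (hpi : (⌊Real.log n⌋₊.primeCounting : ℝ) ≤ 2 * Real.log n / Real.log (Real.log n))
    (hpi' : (n.primeCounting : ℝ) ≤ 2 * n / Real.log n)
    (hsmall : 24 * Real.log (Real.log n) ≤ c * Real.log n)
    (hT : ∀ m ∈ Finset.Icc 2 n, Real.log n < m.minFac → m.minFac ^ 2 ≤ n → m ∈ T) :
    c / 8 * n / Real.log (Real.log n) ≤ T.card := by
  have hn0 : (0 : ℝ) < n := by
    rcases n.eq_zero_or_pos with rfl | h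
    · norm_num at hn
    · exact_mod_cast h
  have hexp : Real.exp (Real.log n / 2) * Real.exp (Real.log n / 2) = n := by
    rw [← Real.exp_add, add_halves, Real.exp_log hn0]
  have hsum := sum_primes_card_coprime_primorial_le hn hlog hpi
  have hcover := card_coprime_primorial_le (n := n) (w := ⌊Real.log n / 4⌋₊)
    (K := ⌊Real.log n⌋₊) (T := T) fun m hm hlt ↦ hT m hm ((Nat.floor_lt (by linarith)).mp hlt)
  have hln : Real.log n ≤ n := Real.log_le_self hn0.le
  have hPle := primorial_floor_div_four_le (x := Real.log n) (by linarith)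
  have hle := two_mul_le_exp_half hn
  have hw : 2 ≤ ⌊Real.log n / 4⌋₊ := Nat.le_floor (by norm_num; linarith)
  have hρ : c / Real.log (Real.log n) ≤
      (primorial ⌊Real.log n / 4⌋₊).totient / primorial ⌊Real.log n / 4⌋₊ := by
    rw [totient_primorial_div]
    refine le_trans ?_ (hprod _ hw)
    have hw1 : (1 : ℝ) < ⌊Real.log n / 4⌋₊ := by exact_mod_cast hw
    have hwl : (⌊Real.log n / 4⌋₊ : ℝ) ≤ Real.log n :=
      (Nat.floor_le (by linarith)).trans (by linarith)
    have := Real.log_pos hw1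
    gcongr
  have h2P : 2 * primorial ⌊Real.log n / 4⌋₊ ≤ n := by
    have : 2 * (primorial ⌊Real.log n / 4⌋₊ : ℝ) ≤ n := by
      refine le_trans ?_ hexp.le
      gcongr
      linarith
    exact_mod_cast this
  have hlow := le_card_Ico_filter_coprime (primorial_ne_zero ⌊Real.log n / 4⌋₊) h2P 1
  have hcover' := (Nat.cast_le (α := ℝ)).mpr hcover
  push_cast at hcover'
  set l := Real.log n
  set ρ : ℝ := (primorial ⌊l / 4⌋₊).totient / primorial ⌊l / 4⌋₊
  have hmain : c / Real.log l * n ≤ ρ * n := by gcongr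
  have hone : 1 ≤ n / l := (one_le_div (by linarith)).mpr hln
  have herr : 3 * (n / l) ≤ c / Real.log l * n / 8 := by
    rw [show c / Real.log l * n / 8 = c * n / (8 * Real.log l) by field_simp,
      show 3 * (n / l) = 3 * n / l by ring, div_le_div_iff₀ (by linarith) (by linarith)]
    nlinarith
  have h1 : c / 8 * n / Real.log l = c / Real.log l * n / 8 := by ring
  have h2 : 2 * n / l = 2 * (n / l) := by ring
  linarith

open scoped Classical in
/-- There exist constants `c₁, c₂ > 0` such that for all sufficiently large `n`,
the number of integers `2 ≤ m ≤ n` whose least prime factor `minFac m` satisfies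
`log n < minFac m` and `(minFac m)² ≤ n` is between `c₁ · n / log log n` and
`c₂ · n / log log n`. -/
theorem count_medium_least_factor :
    ∃ c₁ c₂ : ℝ, 0 < c₁ ∧ 0 < c₂ ∧ ∃ N : ℕ, ∀ n : ℕ, N ≤ n →
      c₁ * n / Real.log (Real.log n) ≤
        (((Finset.Icc 2 n).filter
            (fun m => Real.log n < (Nat.minFac m : ℝ) ∧
              (Nat.minFac m : ℝ) ^ 2 ≤ (n : ℝ))).card : ℝ) ∧
      (((Finset.Icc 2 n).filter
            (fun m => Real.log n < (Nat.minFac m : ℝ) ∧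
              (Nat.minFac m : ℝ) ^ 2 ≤ (n : ℝ))).card : ℝ) ≤
        c₂ * n / Real.log (Real.log n) := by
  obtain ⟨c, hc, hprod⟩ := exists_div_log_le_prod_primesLE
  have hlogcast : Filter.Tendsto (fun n : ℕ ↦ Real.log n) Filter.atTop Filter.atTop :=
    Real.tendsto_log_atTop.comp tendsto_natCast_atTop_atTop
  have h4 : Real.log 4 + 1 / 2 ≤ 2 := by
    rw [show (4 : ℝ) = 2 ^ 2 by norm_num, Real.log_pow]
    have := Real.log_two_lt_d9
    norm_num
    linarith
  have hpi : ∀ᶠ x : ℝ in Filter.atTop, (⌊x⌋₊.primeCounting : ℝ) ≤ 2 * x / Real.log x := by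
    filter_upwards [Chebyshev.eventually_primeCounting_le (ε := 1 / 2) (by norm_num),
      Filter.eventually_ge_atTop 1] with x hx hx1
    refine hx.trans ?_
    have := Real.log_nonneg hx1
    gcongr
  have hsmall : ∀ᶠ x : ℝ in Filter.atTop, 24 * Real.log x ≤ c * x := by
    filter_upwards [Real.isLittleO_log_id_atTop.bound (show 0 < c / 24 by positivity),
      Filter.eventually_ge_atTop 1] with x hx hx1
    rw [Real.norm_of_nonneg (Real.log_nonneg hx1), id, Real.norm_of_nonneg (by linarith)] at hx
    linarith
  refine ⟨c / 8, 4, by positivity, by norm_num, Filter.eventually_atTop.mp ?_⟩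
  filter_upwards [hlogcast.eventually_ge_atTop 16,
    hlogcast.eventually (Real.tendsto_log_atTop.eventually_ge_atTop 64), hlogcast.eventually hpi,
    tendsto_natCast_atTop_atTop.eventually hpi, hlogcast.eventually hsmall]
    with n hn hlog hpil hpin hsm
  rw [Nat.floor_natCast] at hpin
  refine ⟨le_card_of_log_lt_minFac hc hprod hn hlog hpil hpin hsm fun m hm hlt hsq ↦ ?_,
    card_le_of_log_lt_minFac hn fun m hm ↦ ?_⟩
  · exact Finset.mem_filter.mpr ⟨hm, hlt, by exact_mod_cast hsq⟩
  · have := Finset.mem_filter.mp hm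
    exact ⟨this.1, this.2.1⟩
end
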